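/- For a proper closed ρ-weakly convex function f satisfying the error bound dist(x,S) ≤ μ_e·dist(0, ∂̂f(x)) on [f ≤ f⋆ + ν], the quadratic growth condition holds with constant 1/(4μ_e): dist²(x,S) ≤ 4μ_e·(f(x) − f⋆) for all x ∈ [f ≤ f⋆ + ν]. -/

import Mathlib

open Metric Set Filter

local notation "⟪" x ", " y "⟫_ℝ" => @inner ℝ _ _ x y

noncomputable section

abbrev En (n : ℕ) := EuclideanSpace ℝ (Fin n)

def frechetSubdiff {n : ℕ} (f : En n → ℝ) (x : En n) : Set (En n) :=
  {s | ∀ ε > 0, ∀ᶠ y in nhds x, f x + ⟪s, y - x⟫_ℝ - ε * ‖y - x‖ ≤ f y}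

def convexSubdiff {n : ℕ} (f : En n → ℝ) (x : En n) : Set (En n) :=
  {g | ∀ y, f x + ⟪g, y - x⟫_ℝ ≤ f y}

/-- Convex sandwich: a convex function minorized by a downward cone at `z` has a small subgradient. -/
theorem exists_small_subgradient {n : ℕ} (h : En n → ℝ) (z : En n) (l : ℝ) (hl : 0 ≤ l)
    (hc : ConvexOn ℝ Set.univ h) (hz : ∀ y, h z - l * ‖y - z‖ ≤ h y) :
    ∃ s : En n, ‖s‖ ≤ l ∧ ∀ y, h z + ⟪s, y - z⟫_ℝ ≤ h y := by
  have hA : Convex ℝ {p : En n × ℝ | p.1 ∈ Set.univ ∧ h p.1 ≤ p.2} := hc.convex_epigraph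
  have hcone : ConcaveOn ℝ Set.univ (fun y : En n => h z - l * ‖y - z‖) := by
    refine ⟨convex_univ, ?_⟩
    intro a _ b _ p q hp hq hpq
    have e : p • a + q • b - z = p • (a - z) + q • (b - z) := by
      have : z = (p + q) • z := by rw [hpq, one_smul]
      nth_rewrite 1 [this]
      module
    have h1 : ‖p • a + q • b - z‖ ≤ p * ‖a - z‖ + q * ‖b - z‖ := by
      rw [e]
      refine (norm_add_le _ _).trans ?_
      rw [norm_smul, norm_smul, Real.norm_of_nonneg hp, Real.norm_of_nonneg hq]
    have h2 := mul_le_mul_of_nonneg_left h1 hl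
    simp only [smul_eq_mul]
    have h3 : h z = p * h z + q * h z := by rw [← add_mul, hpq, one_mul]
    linarith
  have hB : Convex ℝ {p : En n × ℝ | p.1 ∈ Set.univ ∧ p.2 < h z - l * ‖p.1 - z‖} :=
    hcone.convex_strict_hypograph
  have hBo : IsOpen {p : En n × ℝ | p.1 ∈ Set.univ ∧ p.2 < h z - l * ‖p.1 - z‖} := by
    simp only [mem_univ, true_and]
    exact isOpen_lt (by fun_prop) (by fun_prop)
  have hd : Disjoint {p : En n × ℝ | p.1 ∈ Set.univ ∧ p.2 < h z - l * ‖p.1 - z‖}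
      {p : En n × ℝ | p.1 ∈ Set.univ ∧ h p.1 ≤ p.2} := by
    rw [Set.disjoint_left]
    rintro p ⟨_, h1⟩ ⟨_, h2⟩
    have := hz p.1
    linarith
  obtain ⟨F, u, hF1, hF2⟩ := geometric_hahn_banach_open hB hBo hA hd
  have hdec : ∀ y t, F (y, t) = F (y, 0) + t * F (0, 1) := by
    intro y t
    have : ((y, t) : En n × ℝ) = (y, 0) + t • (0, 1) := by simp
    rw [this, map_add, map_smul, smul_eq_mul]
  set c := F (0, 1) with hcdef
  have hBv : ∀ y t, t < h z - l * ‖y - z‖ → F (y, 0) + t * c < u := by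
    intro y t ht
    rw [← hdec]
    exact hF1 _ ⟨mem_univ _, ht⟩
  have hAv : ∀ y, u ≤ F (y, 0) + h y * c := by
    intro y
    rw [← hdec]
    exact hF2 _ ⟨mem_univ _, le_rfl⟩
  have hcpos : 0 < c := by
    have h1 := hBv z (h z - 1) (by simp)
    have h2 := hAv z
    linarith
  have hBle : ∀ y, F (y, 0) + (h z - l * ‖y - z‖) * c ≤ u := by
    intro y
    by_contra hcon
    push Not at hcon
    have hδ : 0 < (F (y, 0) + (h z - l * ‖y - z‖) * c - u) / c := by
      apply div_pos _ hcpos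
      linarith
    have h1 := hBv y (h z - l * ‖y - z‖ - (F (y, 0) + (h z - l * ‖y - z‖) * c - u) / c)
      (by linarith)
    rw [sub_mul, div_mul_cancel₀ _ hcpos.ne'] at h1
    linarith
  have hu : u = F (z, 0) + h z * c := by
    apply le_antisymm (hAv z)
    simpa using hBle z
  let L : En n →L[ℝ] ℝ := F.comp (ContinuousLinearMap.inl ℝ (En n) ℝ)
  have hL : ∀ v, F (v, 0) = L v := by intro v; simp [L]
  let w : En n := (InnerProductSpace.toDual ℝ (En n)).symm L
  have hw : ∀ v, ⟪w, v⟫_ℝ = L v := by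
    intro v
    exact InnerProductSpace.toDual_symm_apply
  refine ⟨-(c⁻¹ • w), ?_, ?_⟩
  · have h1 := hBle (z + w)
    rw [hu, hL, hL, map_add, ← hw w, real_inner_self_eq_norm_sq, add_sub_cancel_left] at h1
    have h2 : ‖w‖ * ‖w‖ ≤ (l * c) * ‖w‖ := by nlinarith
    have h3 : ‖w‖ ≤ l * c := by
      by_cases h0 : ‖w‖ = 0
      · rw [h0]; positivity
      · exact le_of_mul_le_mul_right h2 (lt_of_le_of_ne (norm_nonneg _) (Ne.symm h0))
    rw [norm_neg, norm_smul, norm_inv, Real.norm_of_nonneg hcpos.le, inv_mul_le_iff₀ hcpos]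
    linarith
  · intro y
    have h1 := hAv y
    rw [hu, hL, hL] at h1
    rw [inner_neg_left, real_inner_smul_left, hw, map_sub]
    have h2 : (h z - h y) * c ≤ L y - L z := by linarith
    have h3 : h z - h y ≤ c⁻¹ * (L y - L z) := by
      rw [inv_mul_eq_div, le_div_iff₀ hcpos]
      exact h2
    linarith

/-- Ekeland-type point: in finite dimension the penalized function attains its minimum. -/
theorem exists_penalized_min {n : ℕ} (f : En n → ℝ) (fstar l : ℝ) (hl : 0 < l)
    (hlsc : LowerSemicontinuous f) (hlb : ∀ y, fstar ≤ f y) (x : En n) :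
    ∃ z, ∀ y, f z + l * ‖z - x‖ ≤ f y + l * ‖y - x‖ := by
  have hr : 0 ≤ (f x - fstar) / l := div_nonneg (by linarith [hlb x]) hl.le
  have hcont : Continuous (fun y : En n => l * ‖y - x‖) := by fun_prop
  have hls : LowerSemicontinuous (fun y => f y + l * ‖y - x‖) :=
    hlsc.add hcont.lowerSemicontinuous
  have hxm : x ∈ closedBall x ((f x - fstar) / l) := mem_closedBall_self hr
  obtain ⟨z, hz, hmin⟩ := (hls.lowerSemicontinuousOn _).exists_isMinOn ⟨x, hxm⟩
    (isCompact_closedBall x ((f x - fstar) / l))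
  refine ⟨z, fun y => ?_⟩
  by_cases hy : y ∈ closedBall x ((f x - fstar) / l)
  · exact hmin hy
  · have h1 : f z + l * ‖z - x‖ ≤ f x + l * ‖x - x‖ := hmin hxm
    rw [sub_self, norm_zero, mul_zero, add_zero] at h1
    rw [mem_closedBall, dist_eq_norm, not_le, div_lt_iff₀ hl] at hy
    linarith [hlb y]

/-- For a proper closed ρ-weakly convex f satisfying the error bound
with constant μ_e on [f ≤ f⋆ + ν], quadratic growth holds there:
dist²(x,S) ≤ 4μ_e·(f(x) − f⋆). -/
theorem eb_implies_qg {n : ℕ} (f : En n → ℝ) (ρ ν μe fstar : ℝ)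
    (hρ : 0 ≤ ρ) (hν : 0 < ν) (hμe : 0 < μe)
    (hlsc : LowerSemicontinuous f)
    (hwc : ConvexOn ℝ Set.univ (fun x => f x + ρ / 2 * ‖x‖ ^ 2))
    (hlb : ∀ y, fstar ≤ f y)
    (S : Set (En n)) (hS : S = {x | f x = fstar}) (hne : S.Nonempty)
    (hEB : ∀ x ∈ {z : En n | f z ≤ fstar + ν},
      infDist x S ≤ μe * infDist (0 : En n) (frechetSubdiff f x)) :
    ∀ x ∈ {z : En n | f z ≤ fstar + ν},
      (infDist x S) ^ 2 ≤ 4 * μe * (f x - fstar) := by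
  intro x hx
  simp only [mem_ofPred_eq] at hx hEB
  rcases (hlb x).eq_or_lt with h0 | h0
  · have hxS : x ∈ S := by rw [hS]; exact h0.symm
    rw [infDist_zero_of_mem hxS, ← h0]
    simp
  have hε : 0 < f x - fstar := by linarith
  set r := √(μe * (f x - fstar)) with hrdef
  have hr : 0 < r := Real.sqrt_pos.mpr (by positivity)
  have hr2 : r ^ 2 = μe * (f x - fstar) := Real.sq_sqrt (by positivity)
  set l := r / μe with hldef
  have hl : 0 < l := by positivity
  have hμl : μe * l = r := by rw [hldef]; field_simp
  obtain ⟨z, hz⟩ := exists_penalized_min f fstar l hl hlsc hlb x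
  have hzx := hz x
  rw [sub_self, norm_zero, mul_zero, add_zero] at hzx
  have hfz : f z ≤ fstar + ν := by
    have : 0 ≤ l * ‖z - x‖ := by positivity
    linarith
  have hdist : ‖z - x‖ ≤ r := by
    have h1 : l * ‖z - x‖ ≤ f x - fstar := by linarith [hlb z]
    have h2 : r * ‖z - x‖ ≤ r * r := by
      have := mul_le_mul_of_nonneg_left h1 hμe.le
      rw [← mul_assoc, hμl] at this
      nlinarith
    exact le_of_mul_le_mul_left h2 hr
  have hconv : ConvexOn ℝ Set.univ (fun y => f y + ρ / 2 * ‖y - z‖ ^ 2) := by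
    have hlin : ConvexOn ℝ Set.univ (fun y : En n => (-ρ) * ⟪z, y⟫_ℝ + ρ / 2 * ‖z‖ ^ 2) := by
      refine ⟨convex_univ, ?_⟩
      intro a _ b _ p q hp hq hpq
      simp only [smul_eq_mul, inner_add_right, real_inner_smul_right]
      have : ρ / 2 * ‖z‖ ^ 2 = (p + q) * (ρ / 2 * ‖z‖ ^ 2) := by rw [hpq, one_mul]
      apply le_of_eq
      linear_combination this
    refine (hwc.add hlin).congr ?_
    intro y _
    simp only [Pi.add_apply]
    rw [norm_sub_sq_real, real_inner_comm z y]
    ring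
  obtain ⟨s, hs, hsub⟩ := exists_small_subgradient _ z l hl.le hconv (by
    intro y
    have h1 := hz y
    have h2 : ‖y - x‖ ≤ ‖y - z‖ + ‖z - x‖ := norm_sub_le_norm_sub_add_norm_sub y z x
    have h3 := mul_le_mul_of_nonneg_left h2 hl.le
    have h4 : 0 ≤ ρ / 2 * ‖y - z‖ ^ 2 := by positivity
    simp only [sub_self, norm_zero]
    linarith)
  have hsF : s ∈ frechetSubdiff f z := by
    intro e he
    have hc : Filter.Tendsto (fun y : En n => ρ / 2 * ‖y - z‖) (nhds z) (nhds 0) := by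
      have : Continuous (fun y : En n => ρ / 2 * ‖y - z‖) := by fun_prop
      simpa using this.tendsto z
    filter_upwards [hc.eventually (gt_mem_nhds he)] with y hy
    have h1 := hsub y
    simp only [sub_self, norm_zero] at h1
    have h2 := mul_le_mul_of_nonneg_right hy.le (norm_nonneg (y - z))
    linarith
  have h1 : infDist (0 : En n) (frechetSubdiff f z) ≤ l := by
    refine (infDist_le_dist_of_mem hsF).trans ?_
    rwa [dist_zero_left]
  have h2 : infDist z S ≤ r := by
    refine (hEB z hfz).trans ?_
    rw [← hμl]
    exact mul_le_mul_of_nonneg_left h1 hμe.le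
  have h3 : infDist x S ≤ 2 * r := by
    have := infDist_le_infDist_add_dist (s := S) (x := x) (y := z)
    rw [dist_comm, dist_eq_norm] at this
    linarith
  have h4 : (0:ℝ) ≤ infDist x S := infDist_nonneg
  nlinarith
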